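/- Let $\varphi:\Sigma\to\mathbb{R}$ be continuous on the full shift over a finite alphabet, and set $\alpha_{\min}=\inf\{\int\varphi\,d\mu:\mu\in\mathcal{M}_\sigma(\Sigma)\}$, $\alpha_{\max}=\sup\{\int\varphi\,d\mu:\mu\in\mathcal{M}_\sigma(\Sigma)\}$. Then for $\alpha\in\mathbb{R}$, the level set $\Sigma^{\varphi}_{\alpha}=\{\omega:\lim_{n\to\infty}\frac{1}{n}\sum_{l=0}^{n-1}\varphi(\sigma^l\omega)=\alpha\}$ is nonempty if and only if $\alpha\in[\alpha_{\min},\alpha_{\max}]$. -/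

import Mathlib

open Filter Topology Finset MeasureTheory
open scoped ENNReal NNReal

/-- Along every orbit of a continuous self-map of a compact metrizable space, the limit of the
Birkhoff averages of a continuous function is its integral against an invariant measure. -/
theorem exists_invariant_integral_eq_of_tendsto_birkhoffAverage {X : Type*} [TopologicalSpace X]
    [CompactSpace X] [TopologicalSpace.MetrizableSpace X] [MeasurableSpace X] [BorelSpace X]
    {T : X → X} (hT : Continuous T) {φ : X → ℝ} (hφ : Continuous φ) {x : X} {α : ℝ}
    (h : Tendsto (fun n => birkhoffAverage ℝ T φ n x) atTop (𝓝 α)) :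
    ∃ μ : Measure X, IsProbabilityMeasure μ ∧ μ.map T = μ ∧ ∫ y, φ y ∂μ = α := by
  let P : ℕ → Measure X := fun n =>
    ((n : ℝ≥0∞) + 1)⁻¹ • ∑ l ∈ range (n + 1), Measure.dirac (T^[l] x)
  have hP : ∀ n, IsProbabilityMeasure (P n) := fun n => ⟨by
    simp only [P, Measure.smul_apply, Measure.finsetSum_apply, measure_univ, sum_const, card_range,
      smul_eq_mul, nsmul_eq_mul, mul_one, Nat.cast_add, Nat.cast_one]
    exact ENNReal.inv_mul_cancel (by simp) (by finiteness)⟩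
  have hPint : ∀ n (f : X → ℝ), Continuous f → ∫ y, f y ∂(P n) = birkhoffAverage ℝ T f (n + 1) x := by
    intro n f hf
    simp only [P]
    rw [integral_smul_measure, integral_finsetSum_measure
      (fun i _ => integrable_dirac (by simp)), birkhoffAverage, birkhoffSum]
    simp only [integral_dirac]
    congr 1
    rw [ENNReal.toReal_inv, ENNReal.toReal_add (by simp) (by simp)]
    simp
  let Q : ℕ → ProbabilityMeasure X := fun n => ⟨P n, hP n⟩
  let U : Ultrafilter (ProbabilityMeasure X) := (hyperfilter ℕ).map Q
  obtain ⟨μ, -, hμ⟩ := isCompact_univ.ultrafilter_le_nhds U (by simp)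
  have hU : (hyperfilter ℕ : Filter ℕ) ≤ atTop := by
    rw [← Nat.cofinite_eq_atTop]; exact hyperfilter_le_cofinite
  have hlim : ∀ f : X → ℝ, Continuous f →
      Tendsto (fun n => birkhoffAverage ℝ T f (n + 1) x) (hyperfilter ℕ)
        (𝓝 (∫ y, f y ∂(μ : Measure X))) := by
    intro f hf
    have := ProbabilityMeasure.tendsto_iff_forall_integral_tendsto.1
      (show Tendsto Q (hyperfilter ℕ) (𝓝 μ) from hμ) (BoundedContinuousFunction.mkOfCompact ⟨f, hf⟩)
    exact this.congr fun n => hPint n f hf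
  refine ⟨μ, inferInstance, ?_, ?_⟩
  · have := Measure.isProbabilityMeasure_map (μ := (μ : Measure X)) hT.measurable.aemeasurable
    refine ext_of_forall_integral_eq_of_IsFiniteMeasure fun f => ?_
    rw [integral_map hT.measurable.aemeasurable f.continuous.aestronglyMeasurable]
    have h₁ := (hlim _ (f.continuous.comp hT)).sub (hlim _ f.continuous)
    have h₂ := ((tendsto_birkhoffAverage_apply_sub_birkhoffAverage' ℝ f.isBounded_range T x).comp
      (tendsto_add_atTop_nat 1)).mono_left hU
    refine sub_eq_zero.1 (tendsto_nhds_unique h₁ (h₂.congr fun n => ?_))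
    simp only [Function.comp_apply, birkhoffAverage, birkhoffSum,
      ← Function.iterate_succ_apply T, Function.iterate_succ_apply' T]
  · exact tendsto_nhds_unique (hlim φ hφ) ((h.comp (tendsto_add_atTop_nat 1)).mono_left hU)

theorem MeasureTheory.MeasurePreserving.integral_birkhoffSum {X : Type*} [MeasurableSpace X]
    {μ : Measure X} {T : X → X} (hT : MeasurePreserving T μ μ) {φ : X → ℝ}
    (hφ : Integrable φ μ) (n : ℕ) :
    ∫ x, birkhoffSum T φ n x ∂μ = n * ∫ x, φ x ∂μ := by
  simp only [birkhoffSum]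
  rw [integral_finsetSum (f := fun i x => φ (T^[i] x)) _
    fun i _ => (hT.iterate i).integrable_comp_of_integrable hφ]
  have : ∀ i, ∫ x, φ (T^[i] x) ∂μ = ∫ x, φ x ∂μ := fun i => by
    have hi := hT.iterate i
    conv_rhs => rw [← hi.map_eq]
    rw [integral_map hi.measurable.aemeasurable]
    rw [hi.map_eq]
    exact hφ.aestronglyMeasurable
  simp [this]

theorem continuous_birkhoffSum {X : Type*} [TopologicalSpace X] {T : X → X} (hT : Continuous T)
    {φ : X → ℝ} (hφ : Continuous φ) (n : ℕ) : Continuous (birkhoffSum T φ n) := by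
  unfold birkhoffSum
  exact continuous_finsetSum _ fun i _ => hφ.comp (hT.iterate i)

/-- A number bounded by a supremum of integrals against invariant measures is attained or
exceeded by a Birkhoff average of any given length. -/
theorem exists_le_birkhoffSum_of_le_sSup {X : Type*} [TopologicalSpace X]
    [CompactSpace X] [MeasurableSpace X] [BorelSpace X]
    {T : X → X} (hT : Continuous T) {φ : X → ℝ} (hφ : Continuous φ) {M : Set (Measure X)}
    (hM : ∀ μ ∈ M, IsProbabilityMeasure μ ∧ μ.map T = μ) (hne : M.Nonempty) {α : ℝ}
    (hα : α ≤ sSup ((fun μ : Measure X => ∫ x, φ x ∂μ) '' M)) {n : ℕ} (hn : 0 < n) :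
    ∃ x, n * α ≤ birkhoffSum T φ n x := by
  have hn' : (0 : ℝ) < n := by exact_mod_cast hn
  have : Nonempty X := by
    obtain ⟨μ, hμ⟩ := hne
    have := (hM μ hμ).1
    exact nonempty_of_isProbabilityMeasure μ
  obtain ⟨x, -, hx⟩ := isCompact_univ.exists_isMaxOn Set.univ_nonempty
    (continuous_birkhoffSum hT hφ n).continuousOn
  refine ⟨x, ?_⟩
  rw [mul_comm, ← le_div_iff₀ hn']
  refine hα.trans (csSup_le (hne.image _) ?_)
  rintro _ ⟨μ, hμ, rfl⟩
  obtain ⟨_, hinv⟩ := hM μ hμ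
  have hint : ∀ {f : X → ℝ}, Continuous f → Integrable f μ := fun hf =>
    hf.integrable_of_hasCompactSupport (HasCompactSupport.of_compactSpace _)
  have hmp : MeasurePreserving T μ μ := ⟨hT.measurable, hinv⟩
  rw [le_div_iff₀ hn', mul_comm, ← hmp.integral_birkhoffSum (hint hφ)]
  calc ∫ y, birkhoffSum T φ n y ∂μ ≤ ∫ _, birkhoffSum T φ n x ∂μ :=
        integral_mono (hint (continuous_birkhoffSum hT hφ n)) (integrable_const _)
          fun y => hx (Set.mem_univ y)
    _ = birkhoffSum T φ n x := by simp

theorem exists_birkhoffSum_le_of_sInf_le {X : Type*} [TopologicalSpace X]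
    [CompactSpace X] [MeasurableSpace X] [BorelSpace X]
    {T : X → X} (hT : Continuous T) {φ : X → ℝ} (hφ : Continuous φ) {M : Set (Measure X)}
    (hM : ∀ μ ∈ M, IsProbabilityMeasure μ ∧ μ.map T = μ) (hne : M.Nonempty) {α : ℝ}
    (hα : sInf ((fun μ : Measure X => ∫ x, φ x ∂μ) '' M) ≤ α) {n : ℕ} (hn : 0 < n) :
    ∃ x, birkhoffSum T φ n x ≤ n * α := by
  obtain ⟨x, hx⟩ := exists_le_birkhoffSum_of_le_sSup hT hφ.neg hM hne (α := -α) (by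
    rw [Real.sInf_def, ← Set.image_neg_eq_neg, Set.image_image] at hα
    simpa [integral_neg] using neg_le_neg hα) hn
  refine ⟨x, ?_⟩
  have : birkhoffSum T (-φ) n x = -birkhoffSum T φ n x := birkhoffSum_neg T φ n x
  have hx' : n * -α ≤ birkhoffSum T (-φ) n x := hx
  linarith

/-- Cesàro means of a bounded real sequence tend to zero as soon as its means over the blocks
between consecutive squares do. -/
theorem tendsto_sum_range_div_of_square_blocks {u : ℕ → ℝ} {B : ℝ} (hB : ∀ l, |u l| ≤ B)
    (h : ∀ ε > 0, ∀ᶠ k : ℕ in atTop,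
      |∑ l ∈ range (2 * k + 1), u (k ^ 2 + l)| ≤ ε * (2 * k + 1)) :
    Tendsto (fun n : ℕ => (∑ l ∈ range n, u l) / n) atTop (𝓝 0) := by
  have hB₀ : 0 ≤ B := (abs_nonneg _).trans (hB 0)
  have hbound : ∀ m n, |∑ l ∈ range n, u (m + l)| ≤ B * n := fun m n =>
    (abs_sum_le_sum_abs _ _).trans <|
      (sum_le_sum fun l _ => hB (m + l)).trans_eq (by simp [mul_comm])
  rw [Metric.tendsto_atTop]
  intro ε hε
  obtain ⟨K, hK⟩ := eventually_atTop.1 (h (ε / 2) (half_pos hε))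
  have hsq : ∀ k, K ≤ k → |∑ l ∈ range (k ^ 2), u l| ≤ B * K ^ 2 + ε / 2 * (k ^ 2 - K ^ 2) := by
    intro k hk
    induction k, hk using Nat.le_induction with
    | base =>
      have := hbound 0 (K ^ 2)
      push_cast at this
      simpa using this
    | succ k hk ih =>
      rw [show (k + 1) ^ 2 = k ^ 2 + (2 * k + 1) by ring, sum_range_add]
      refine (abs_add_le _ _).trans ((add_le_add ih (hK k hk)).trans_eq ?_)
      push_cast; ring
  have hmain : ∀ n : ℕ, K ^ 2 ≤ n →
      |∑ l ∈ range n, u l| ≤ ε / 2 * n + (B * K ^ 2 + B * (2 * √n)) := by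
    intro n hn
    have h₁ := hsq (Nat.sqrt n) (Nat.le_sqrt'.2 hn)
    have h₂ := hbound (Nat.sqrt n ^ 2) (n - Nat.sqrt n ^ 2)
    have hle := Nat.sqrt_le' n
    have hlt : n ≤ n.sqrt ^ 2 + 2 * n.sqrt := by have := Nat.sqrt_le_add n; nlinarith
    have h₃ : ((n - n.sqrt ^ 2 : ℕ) : ℝ) ≤ 2 * √n := by
      have h₄ : ((n - n.sqrt ^ 2 : ℕ) : ℝ) ≤ (2 * n.sqrt : ℕ) := by
        exact_mod_cast (by omega : n - n.sqrt ^ 2 ≤ 2 * n.sqrt)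
      refine h₄.trans ?_
      push_cast
      linarith [Real.nat_sqrt_le_real_sqrt (a := n)]
    have hle' : ((n.sqrt : ℝ)) ^ 2 ≤ n := by exact_mod_cast hle
    calc |∑ l ∈ range n, u l|
        = |∑ l ∈ range (n.sqrt ^ 2), u l
            + ∑ l ∈ range (n - n.sqrt ^ 2), u (n.sqrt ^ 2 + l)| := by
          rw [← sum_range_add, Nat.add_sub_cancel' hle]
      _ ≤ (B * K ^ 2 + ε / 2 * (n.sqrt ^ 2 - K ^ 2)) + B * (2 * √n) :=
          (abs_add_le _ _).trans (add_le_add h₁ (h₂.trans (mul_le_mul_of_nonneg_left h₃ hB₀)))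
      _ ≤ _ := by nlinarith [sq_nonneg (K : ℝ)]
  have hlim : Tendsto (fun n : ℕ => B * K ^ 2 / (n : ℝ) + B * 2 / √n) atTop (𝓝 0) := by
    have hs : Tendsto (fun n : ℕ => √(n : ℝ)) atTop atTop :=
      Real.tendsto_sqrt_atTop.comp tendsto_natCast_atTop_atTop
    simpa using (tendsto_const_nhds.div_atTop tendsto_natCast_atTop_atTop).add
      (tendsto_const_nhds.div_atTop hs)
  obtain ⟨N, hN⟩ := eventually_atTop.1 (hlim.eventually (gt_mem_nhds (half_pos hε)))
  refine ⟨max (max N (K ^ 2)) 1, fun n hn => ?_⟩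
  simp only [max_le_iff] at hn
  have hn₀ : (0 : ℝ) < n := by exact_mod_cast hn.2
  have hs₀ : 0 < √(n : ℝ) := Real.sqrt_pos.2 hn₀
  rw [Real.dist_eq, sub_zero, abs_div, abs_of_pos hn₀, div_lt_iff₀ hn₀]
  refine (hmain n hn.1.2).trans_lt ?_
  have h₁ : (B * K ^ 2 / (n : ℝ) + B * 2 / √n) * n < ε / 2 * n :=
    mul_lt_mul_of_pos_right (hN n hn.1.1) hn₀
  have h₂ : (B * K ^ 2 / (n : ℝ) + B * 2 / √n) * n = B * K ^ 2 + B * (2 * √n) := by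
    have : (n : ℝ) = √n * √n := (Real.mul_self_sqrt hn₀.le).symm
    rw [add_mul, div_mul_cancel₀ _ hn₀.ne', div_mul_eq_mul_div, add_right_inj, div_eq_iff hs₀.ne']
    rw [mul_assoc B, mul_assoc, mul_assoc, ← this]
  linarith

/-- The left shift on one-sided sequences. -/
def leftShift {D : Type*} (ω : ℕ → D) : ℕ → D := fun n => ω (n + 1)

theorem leftShift_iterate {D : Type*} (l : ℕ) (ω : ℕ → D) :
    leftShift^[l] ω = fun m => ω (m + l) := by
  induction l generalizing ω with
  | zero => rfl
  | succ l ih =>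
    rw [Function.iterate_succ_apply, ih]
    funext m
    simp only [leftShift]
    congr 1

theorem continuous_leftShift {D : Type*} [TopologicalSpace D] :
    Continuous (leftShift : (ℕ → D) → ℕ → D) :=
  continuous_pi fun n => continuous_apply (n + 1)

section Shift

variable {D : Type*} [Finite D] [TopologicalSpace D] [DiscreteTopology D] {φ : (ℕ → D) → ℝ}

theorem exists_forall_abs_sub_le_of_agree (hφ : Continuous φ) {ε : ℝ} (hε : 0 < ε) :
    ∃ m : ℕ, ∀ x y : ℕ → D, (∀ i < m, x i = y i) → |φ x - φ y| ≤ ε := by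
  let _ : MetricSpace (ℕ → D) := PiNat.metricSpace
  obtain ⟨δ, hδ, H⟩ := Metric.uniformContinuous_iff.1
    (CompactSpace.uniformContinuous_of_continuous hφ) ε hε
  obtain ⟨m, hm⟩ := exists_pow_lt_of_lt_one hδ (one_half_lt_one (α := ℝ))
  refine ⟨m, fun x y hxy => (H (lt_of_le_of_lt ?_ hm)).le⟩
  exact PiNat.mem_cylinder_iff_dist_le.1 hxy

/-- Birkhoff sums of length `n` along two sequences whose first `n` symbols differ in at most one
place are `o(n)`-close. -/
theorem exists_forall_abs_birkhoffSum_sub_le (hφ : Continuous φ) {ε : ℝ} (hε : 0 < ε) :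
    ∃ B : ℝ, ∀ (n j : ℕ) (x y : ℕ → D), (∀ i < n, i ≠ j → x i = y i) →
      |birkhoffSum leftShift φ n x - birkhoffSum leftShift φ n y| ≤ ε * n + B := by
  obtain ⟨m, hm⟩ := exists_forall_abs_sub_le_of_agree hφ hε
  obtain ⟨C, hC⟩ := isCompact_univ.exists_bound_of_continuousOn hφ.continuousOn
  have hC' : ∀ x, |φ x| ≤ C := fun x => hC x (Set.mem_univ x)
  refine ⟨2 * m * (2 * C), fun n j x y hxy => ?_⟩
  have hC₀ : 0 ≤ C := (abs_nonneg _).trans (hC' x)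
  let F : Finset ℕ := Ico (j + 1 - m) (j + 1) ∪ Ico (n - m) n
  have hF : (F.card : ℝ) ≤ 2 * m := by
    have : F.card ≤ 2 * m := (card_union_le _ _).trans (by simp only [Nat.card_Ico]; omega)
    exact_mod_cast this
  have hterm : ∀ l ∈ range n, |φ (leftShift^[l] x) - φ (leftShift^[l] y)| ≤
      ε + if l ∈ F then 2 * C else 0 := by
    intro l hl
    rw [mem_range] at hl
    split_ifs with hlF
    · have := abs_sub (φ (leftShift^[l] x)) (φ (leftShift^[l] y))
      linarith [hC' (leftShift^[l] x), hC' (leftShift^[l] y)]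
    · rw [add_zero]
      refine hm _ _ fun i hi => ?_
      simp only [F, mem_union, mem_Ico] at hlF
      simp only [leftShift_iterate]
      exact hxy _ (by omega) (by omega)
  calc |birkhoffSum leftShift φ n x - birkhoffSum leftShift φ n y|
      ≤ ∑ l ∈ range n, (ε + if l ∈ F then 2 * C else 0) := by
        rw [birkhoffSum, birkhoffSum, ← sum_sub_distrib]
        exact (abs_sum_le_sum_abs _ _).trans (sum_le_sum hterm)
    _ ≤ ε * n + F.card * (2 * C) := by
        rw [sum_add_distrib, sum_const, card_range, nsmul_eq_mul, mul_comm, ← sum_filter,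
          sum_const, nsmul_eq_mul]
        gcongr
        exact fun l hl => (mem_filter.1 hl).2
    _ ≤ _ := by gcongr

/-- If the Birkhoff sums of length `n` take values on both sides of `n * α`, then they take a
value that is `o(n)`-close to `n * α`. -/
theorem exists_forall_exists_abs_birkhoffSum_sub_mul_le (hφ : Continuous φ) (α : ℝ) {ε : ℝ}
    (hε : 0 < ε) :
    ∃ B : ℝ, ∀ n : ℕ, (∃ x, n * α ≤ birkhoffSum leftShift φ n x) →
      (∃ y, birkhoffSum leftShift φ n y ≤ n * α) →
      ∃ z, |birkhoffSum leftShift φ n z - n * α| ≤ ε * n + B := by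
  obtain ⟨B, hB⟩ := exists_forall_abs_birkhoffSum_sub_le hφ hε
  refine ⟨B, fun n ⟨x, hx⟩ ⟨y, hy⟩ => ?_⟩
  let z : ℕ → ℕ → D := fun j i => if i < j then x i else y i
  have hz₀ : z 0 = y := by funext i; simp [z]
  have hzn : |birkhoffSum leftShift φ n x - birkhoffSum leftShift φ n (z n)| ≤ ε * n + B :=
    hB n 0 _ _ fun i hi _ => by simp [z, hi]
  have hstep : ∀ j, |birkhoffSum leftShift φ n (z (j + 1)) - birkhoffSum leftShift φ n (z j)| ≤
      ε * n + B := fun j => hB n j _ _ fun i _ hij => by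
    have : i < j + 1 ↔ i < j := by omega
    simp [z, this]
  by_cases h : ∃ j, n * α < birkhoffSum leftShift φ n (z j)
  · classical
    obtain ⟨j, hj⟩ : ∃ j, Nat.find h = j + 1 :=
      Nat.exists_eq_succ_of_ne_zero fun h₀ => by
        have := Nat.find_spec h
        rw [h₀, hz₀] at this
        exact this.not_ge hy
    have h₁ := Nat.find_spec h
    have h₂ := Nat.find_min h (m := j) (by omega)
    rw [hj] at h₁
    refine ⟨z (j + 1), ?_⟩
    rw [abs_of_pos (sub_pos.2 h₁)]
    linarith [(abs_le.1 (hstep j)).2]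
  · push Not at h
    refine ⟨z n, ?_⟩
    rw [abs_of_nonpos (sub_nonpos.2 (h n))]
    linarith [(abs_le.1 hzn).2]

/-- Concatenating words of growing length with nearly optimal averages yields a sequence with
prescribed limit of Birkhoff averages. -/
theorem exists_tendsto_birkhoffAverage_leftShift (hφ : Continuous φ) {α : ℝ}
    (hle : ∀ n, 0 < n → ∃ x, n * α ≤ birkhoffSum leftShift φ n x)
    (hge : ∀ n, 0 < n → ∃ y, birkhoffSum leftShift φ n y ≤ n * α) :
    ∃ ω, Tendsto (fun n => birkhoffAverage ℝ leftShift φ n ω) atTop (𝓝 α) := by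
  have hne : (Set.univ : Set (ℕ → D)).Nonempty := ⟨(hle 1 one_pos).choose, trivial⟩
  have hmin : ∀ n : ℕ, ∃ w : ℕ → D, ∀ z,
      |birkhoffSum leftShift φ n w - n * α| ≤ |birkhoffSum leftShift φ n z - n * α| := fun n => by
    obtain ⟨w, -, hw⟩ := isCompact_univ.exists_isMinOn hne
      (((continuous_birkhoffSum continuous_leftShift hφ n).sub
        (continuous_const (y := n * α))).abs.continuousOn)
    exact ⟨w, fun z => hw (Set.mem_univ z)⟩
  choose w hw using hmin
  let ω : ℕ → D := fun m => w (2 * m.sqrt + 1) (m - m.sqrt ^ 2)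
  have hω : ∀ k i, i < 2 * k + 1 → ω (i + k ^ 2) = w (2 * k + 1) i := by
    intro k i hi
    have : (i + k ^ 2).sqrt = k := by
      rw [add_comm, sq]; exact Nat.sqrt_add_eq k (by omega)
    simp [ω, this]
  refine ⟨ω, ?_⟩
  obtain ⟨C, hC⟩ := isCompact_univ.exists_bound_of_continuousOn hφ.continuousOn
  have hlim : Tendsto (fun n : ℕ => (∑ l ∈ range n, (φ (leftShift^[l] ω) - α)) / n)
      atTop (𝓝 0) := by
    refine tendsto_sum_range_div_of_square_blocks (B := C + |α|)
      (fun l => (abs_sub _ _).trans (by gcongr; exact hC _ (Set.mem_univ _))) fun ε hε => ?_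
    obtain ⟨B₁, hB₁⟩ := exists_forall_abs_birkhoffSum_sub_le hφ (ε := ε / 4) (by positivity)
    obtain ⟨B₂, hB₂⟩ :=
      exists_forall_exists_abs_birkhoffSum_sub_mul_le hφ α (ε := ε / 4) (by positivity)
    filter_upwards [(tendsto_natCast_atTop_atTop (R := ℝ)).eventually_ge_atTop ((B₁ + B₂) / ε)]
      with k hk
    rw [div_le_iff₀ hε] at hk
    obtain ⟨z, hz⟩ := hB₂ (2 * k + 1) (hle _ (by omega)) (hge _ (by omega))
    have h₁ := (hw (2 * k + 1) z).trans hz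
    have h₂ := hB₁ (2 * k + 1) 0 (leftShift^[k ^ 2] ω) (w (2 * k + 1)) fun i hi _ => by
      rw [leftShift_iterate]; exact hω k i hi
    have h₃ : ∑ l ∈ range (2 * k + 1), (φ (leftShift^[k ^ 2 + l] ω) - α) =
        birkhoffSum leftShift φ (2 * k + 1) (leftShift^[k ^ 2] ω) - (2 * k + 1 : ℕ) * α := by
      rw [sum_sub_distrib, sum_const, card_range, nsmul_eq_mul, birkhoffSum]
      simp only [add_comm (k ^ 2), Function.iterate_add_apply]
    rw [h₃]
    refine (abs_sub_le _ (birkhoffSum leftShift φ (2 * k + 1) (w (2 * k + 1))) _).trans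
      ((add_le_add h₂ h₁).trans ?_)
    push_cast
    nlinarith
  have := hlim.add_const α
  rw [zero_add] at this
  refine this.congr' ?_
  filter_upwards [eventually_gt_atTop 0] with n hn
  have : (n : ℝ) ≠ 0 := by exact_mod_cast hn.ne'
  rw [birkhoffAverage, birkhoffSum, sum_sub_distrib, sum_const, card_range, nsmul_eq_mul,
    smul_eq_mul]
  field_simp
  ring

end Shift

/-- For a continuous potential `φ` on the full shift over a finite alphabet, the
Birkhoff level set `Σ^φ_α = {ω : (1/n) ∑_{l<n} φ(σ^l ω) → α}` is nonempty if and only if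
`α ∈ [αmin, αmax]`, where `αmin` and `αmax` are the infimum and supremum of `∫ φ dμ`
over all shift-invariant Borel probability measures `μ`. -/
theorem stmt_16 {D : Type*} [Fintype D] [Nonempty D] [TopologicalSpace D]
    [DiscreteTopology D] [MeasurableSpace D] [BorelSpace D]
    (φ : (ℕ → D) → ℝ) (hφ : Continuous φ)
    (M : Set (Measure (ℕ → D)))
    (hM : M = {μ : Measure (ℕ → D) | IsProbabilityMeasure μ ∧
      μ.map (fun ω n => ω (n + 1)) = μ})
    (αmin αmax : ℝ)
    (hαmin : αmin = sInf ((fun μ : Measure (ℕ → D) => ∫ ω, φ ω ∂μ) '' M))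
    (hαmax : αmax = sSup ((fun μ : Measure (ℕ → D) => ∫ ω, φ ω ∂μ) '' M))
    (α : ℝ) :
    (∃ ω : ℕ → D,
        Tendsto (fun n : ℕ => (∑ l ∈ Finset.range n, φ (fun m => ω (m + l))) / n)
          atTop (𝓝 α))
      ↔ α ∈ Set.Icc αmin αmax := by
  have hshift : (fun (ω : ℕ → D) n => ω (n + 1)) = leftShift := rfl
  have havg : ∀ ω : ℕ → D,
      (fun n : ℕ => (∑ l ∈ Finset.range n, φ (fun m => ω (m + l))) / n) =
        fun n => birkhoffAverage ℝ leftShift φ n ω := fun ω => by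
    funext n
    simp only [birkhoffAverage, birkhoffSum, leftShift_iterate, smul_eq_mul]
    rw [div_eq_inv_mul]
  simp only [havg]
  rw [hshift] at hM
  have hmem : ∀ μ ∈ M, IsProbabilityMeasure μ ∧ μ.map leftShift = μ := fun μ hμ => by
    rw [hM] at hμ; exact hμ
  subst hαmin hαmax
  constructor
  · rintro ⟨ω, hω⟩
    obtain ⟨μ, hμ, hinv, rfl⟩ :=
      exists_invariant_integral_eq_of_tendsto_birkhoffAverage continuous_leftShift hφ hω
    have hμM : μ ∈ M := by rw [hM]; exact ⟨hμ, hinv⟩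
    obtain ⟨C, hC⟩ := isCompact_univ.exists_bound_of_continuousOn hφ.continuousOn
    have hbound : ∀ ν ∈ M, |∫ x, φ x ∂ν| ≤ C := fun ν hν => by
      have := (hmem ν hν).1
      simpa using norm_integral_le_of_norm_le_const (μ := ν)
        (Eventually.of_forall fun x => hC x (Set.mem_univ x))
    refine ⟨csInf_le ⟨-C, ?_⟩ ⟨μ, hμM, rfl⟩, le_csSup ⟨C, ?_⟩ ⟨μ, hμM, rfl⟩⟩
    · rintro _ ⟨ν, hν, rfl⟩
      exact (abs_le.1 (hbound ν hν)).1
    · rintro _ ⟨ν, hν, rfl⟩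
      exact (abs_le.1 (hbound ν hν)).2
  · rintro ⟨hmin, hmax⟩
    have hne : M.Nonempty := by
      refine ⟨Measure.dirac fun _ => Classical.arbitrary D, ?_⟩
      rw [hM]
      refine ⟨inferInstance, ?_⟩
      rw [Measure.map_dirac' continuous_leftShift.measurable]
      rfl
    exact exists_tendsto_birkhoffAverage_leftShift hφ
      (fun n hn => exists_le_birkhoffSum_of_le_sSup continuous_leftShift hφ hmem hne hmax hn)
      (fun n hn => exists_birkhoffSum_le_of_sInf_le continuous_leftShift hφ hmem hne hmin hn)
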